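/- Let φ be a non-growing morphism prolongable on a with no letter eventually erased. Then there exists a positive integer p, bounded by an explicit function of the size of A, such that the morphism ψ = φ^p satisfies: for every growing letter c and every l ≥ 2, LB(ψ^l(c)) = LE(c) · LP(c)^{l−2} · LK(c) and RB(ψ^l(c)) = RK(c) · RP(c)^{l−2} · RE(c), where LE, RE, LK, RK, LP, RP are defined with respect to ψ. -/

import Mathlib

open Filter Asymptotics

variable {A : Type*}

/-- Extension of a morphism, given on letters, to words. -/
def wordMap (φ : A → List A) (w : List A) : List A := w.flatMap φ

/-- The factor of the infinite word α of length n starting at position i. -/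
def factorAt (α : ℕ → A) (i n : ℕ) : List A := (List.range n).map (fun j => α (i + j))

/-- w is a factor (contiguous subword) of the infinite word α. -/
def IsFactor (α : ℕ → A) (w : List A) : Prop := ∃ i, w = factorAt α i w.length

/-- The factor complexity of α: the number of distinct factors of length n. -/
noncomputable def complexity (α : ℕ → A) (n : ℕ) : ℕ :=
  Set.ncard {w : List A | w.length = n ∧ IsFactor α w}

def UltimatelyPeriodic (α : ℕ → A) : Prop :=
  ∃ N p : ℕ, 1 ≤ p ∧ ∀ i, N ≤ i → α (i + p) = α i

/-- φ is prolongable on a: φ(a) = a·w with w nonempty and |φ^n(a)| → ∞. -/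
def Prolongable (φ : A → List A) (a : A) : Prop :=
  (∃ w, w ≠ [] ∧ φ a = a :: w) ∧
    Tendsto (fun n => ((wordMap φ)^[n] [a]).length) atTop atTop

/-- α is the pure morphic sequence φ^∞(a): every iterate φ^n(a) is a prefix of α. -/
def IsFixedSeq (φ : A → List A) (a : A) (α : ℕ → A) : Prop :=
  ∀ n, factorAt α 0 ((wordMap φ)^[n] [a]).length = (wordMap φ)^[n] [a]

/-- The letter b is growing for φ: |φ^k(b)| → ∞. -/
def GrowingLetter (φ : A → List A) (b : A) : Prop :=
  Tendsto (fun k => ((wordMap φ)^[k] [b]).length) atTop atTop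

def BoundedLetter (φ : A → List A) (b : A) : Prop := ¬ GrowingLetter φ b

/-- φ is growing: every letter is growing. -/
def Growing (φ : A → List A) : Prop := ∀ b, GrowingLetter φ b

open Classical in
/-- LB(u): the longest prefix of u consisting of bounded letters. -/
noncomputable def LBw (φ : A → List A) (u : List A) : List A :=
  u.takeWhile (fun c => decide (BoundedLetter φ c))

/-- RB(u): the longest suffix of u consisting of bounded letters. -/
noncomputable def RBw (φ : A → List A) (u : List A) : List A := (LBw φ u.reverse).reverse

open Classical in
/-- LC(u): the first growing letter of u (junk value if none). -/
noncomputable def LCl [Inhabited A] (φ : A → List A) (u : List A) : A :=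
  (u.dropWhile (fun c => decide (BoundedLetter φ c))).headI

/-- RC(u): the last growing letter of u (junk value if none). -/
noncomputable def RCl [Inhabited A] (φ : A → List A) (u : List A) : A := LCl φ u.reverse

noncomputable def LEw (ψ : A → List A) (c : A) : List A := wordMap ψ (LBw ψ (ψ c))

noncomputable def REw (ψ : A → List A) (c : A) : List A := wordMap ψ (RBw ψ (ψ c))

noncomputable def LKw [Inhabited A] (ψ : A → List A) (c : A) : List A :=
  LBw ψ (ψ (LCl ψ (ψ c)))

noncomputable def RKw [Inhabited A] (ψ : A → List A) (c : A) : List A :=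
  RBw ψ (ψ (RCl ψ (ψ c)))

noncomputable def LPw [Inhabited A] (ψ : A → List A) (c : A) : List A := wordMap ψ (LKw ψ c)

noncomputable def RPw [Inhabited A] (ψ : A → List A) (c : A) : List A := wordMap ψ (RKw ψ c)

/-- ψ is strongly 1-periodic: for every growing letter c and every l ≥ 2,
LB(ψ^l(c)) = LE(c)·LP(c)^(l-2)·LK(c) and RB(ψ^l(c)) = RK(c)·RP(c)^(l-2)·RE(c). -/
def StronglyOnePeriodic [Inhabited A] (ψ : A → List A) : Prop :=
  ∀ c, GrowingLetter ψ c → ∀ l, 2 ≤ l →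
    LBw ψ ((wordMap ψ)^[l] [c]) =
      LEw ψ c ++ (List.replicate (l - 2) (LPw ψ c)).flatten ++ LKw ψ c ∧
    RBw ψ ((wordMap ψ)^[l] [c]) =
      RKw ψ c ++ (List.replicate (l - 2) (RPw ψ c)).flatten ++ REw ψ c

section Words

variable {φ : A → List A}

theorem wordMap_append (φ : A → List A) (u v : List A) :
    wordMap φ (u ++ v) = wordMap φ u ++ wordMap φ v := by
  simp [wordMap]

theorem wordMap_singleton (φ : A → List A) (c : A) : wordMap φ [c] = φ c := by
  simp [wordMap]

theorem wordMap_iterate_append (φ : A → List A) (k : ℕ) (u v : List A) :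
    (wordMap φ)^[k] (u ++ v) = (wordMap φ)^[k] u ++ (wordMap φ)^[k] v := by
  induction k generalizing u v with
  | zero => rfl
  | succ k ih => simp only [Function.iterate_succ_apply, wordMap_append, ih]

theorem wordMap_iterate_nil (φ : A → List A) (k : ℕ) : (wordMap φ)^[k] [] = [] :=
  Function.iterate_fixed (by simp [wordMap]) k

/-- The morphism of the letter images under `φ ^ p` is the `p`-th iterate of the morphism `φ`. -/
theorem wordMap_power (φ : A → List A) (p : ℕ) :
    wordMap (fun c => (wordMap φ)^[p] [c]) = (wordMap φ)^[p] := by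
  funext w
  induction w with
  | nil => rw [wordMap_iterate_nil]; simp [wordMap]
  | cons c w ih =>
    rw [← List.singleton_append, wordMap_append, wordMap_iterate_append, ih, wordMap_singleton]

theorem mem_wordMap_iterate_add {φ : A → List A} {b z : A} {m n : ℕ}
    (h : z ∈ (wordMap φ)^[m + n] [b]) :
    ∃ y ∈ (wordMap φ)^[m] [b], z ∈ (wordMap φ)^[n] [y] := by
  rw [add_comm, Function.iterate_add_apply, ← wordMap_power φ n] at h
  simpa [wordMap] using h

theorem length_le_length_wordMap (hφ : ∀ c, φ c ≠ []) (w : List A) :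
    w.length ≤ (wordMap φ w).length := by
  induction w with
  | nil => simp
  | cons c w ih =>
    have := List.length_pos_iff.2 (hφ c)
    rw [← List.singleton_append, wordMap_append, wordMap_singleton, List.length_append,
      List.length_append, List.length_singleton]
    omega

theorem monotone_length_iterate (hφ : ∀ c, φ c ≠ []) (w : List A) :
    Monotone fun k => ((wordMap φ)^[k] w).length :=
  monotone_nat_of_le_succ fun k => by
    rw [Function.iterate_succ_apply']
    exact length_le_length_wordMap hφ _

theorem length_iterate_le_of_mem {c : A} {w : List A} (h : c ∈ w) (k : ℕ) :
    ((wordMap φ)^[k] [c]).length ≤ ((wordMap φ)^[k] w).length := by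
  obtain ⟨u, v, rfl⟩ := List.append_of_mem h
  rw [← List.singleton_append (x := c) (l := v), wordMap_iterate_append, wordMap_iterate_append]
  simp only [List.length_append]
  omega

theorem boundedLetter_iff (hφ : ∀ c, φ c ≠ []) (c : A) :
    BoundedLetter φ c ↔ ∃ C, ∀ k, ((wordMap φ)^[k] [c]).length ≤ C := by
  constructor
  · intro h
    by_contra! hC
    exact h (tendsto_atTop_atTop_of_monotone (monotone_length_iterate hφ _)
      fun C => (hC C).imp fun _ => le_of_lt)
  · rintro ⟨C, hC⟩ h
    obtain ⟨k, hk⟩ := (h.eventually_gt_atTop C).exists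
    exact absurd (hC k) (not_le.2 hk)

theorem exists_length_bound_of_bounded (hφ : ∀ c, φ c ≠ []) {w : List A}
    (hw : ∀ c ∈ w, BoundedLetter φ c) : ∃ C, ∀ k, ((wordMap φ)^[k] w).length ≤ C := by
  induction w with
  | nil => exact ⟨0, fun k => by simp [wordMap_iterate_nil]⟩
  | cons c w ih =>
    obtain ⟨C, hC⟩ := (boundedLetter_iff hφ c).1 (hw c (by simp))
    obtain ⟨D, hD⟩ := ih fun d hd => hw d (by simp [hd])
    refine ⟨C + D, fun k => ?_⟩
    rw [← List.singleton_append, wordMap_iterate_append, List.length_append]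
    exact add_le_add (hC k) (hD k)

theorem bounded_of_mem_iterate (hφ : ∀ c, φ c ≠ []) {b y : A} (hb : BoundedLetter φ b) {n : ℕ}
    (hy : y ∈ (wordMap φ)^[n] [b]) : BoundedLetter φ y := by
  obtain ⟨C, hC⟩ := (boundedLetter_iff hφ b).1 hb
  refine (boundedLetter_iff hφ y).2 ⟨C, fun k => ?_⟩
  refine (length_iterate_le_of_mem hy k).trans ?_
  rw [← Function.iterate_add_apply]
  exact hC _

theorem bounded_of_mem (hφ : ∀ c, φ c ≠ []) {b y : A} (hb : BoundedLetter φ b)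
    (hy : y ∈ φ b) : BoundedLetter φ y :=
  bounded_of_mem_iterate hφ hb (n := 1) (by simpa [wordMap_singleton] using hy)

theorem exists_growing_mem (hφ : ∀ c, φ c ≠ []) {c : A} (hc : GrowingLetter φ c) :
    ∃ d ∈ φ c, GrowingLetter φ d := by
  by_contra! h
  obtain ⟨C, hC⟩ := exists_length_bound_of_bounded hφ h
  refine (boundedLetter_iff hφ c).2 ⟨C, fun k => ?_⟩ hc
  refine (monotone_length_iterate hφ [c] (Nat.le_succ k)).trans ?_
  simpa [Function.iterate_succ_apply, wordMap_singleton] using hC k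

theorem wordMap_iterate_ne_nil (hφ : ∀ c, φ c ≠ []) (p : ℕ) (c : A) :
    (wordMap φ)^[p] [c] ≠ [] := by
  have := monotone_length_iterate hφ [c] (Nat.zero_le p)
  exact List.length_pos_iff.1 this

/-- A power of a non-erasing morphism has the same growing letters. -/
theorem growingLetter_power (hφ : ∀ c, φ c ≠ []) {p : ℕ} (hp : 0 < p) :
    GrowingLetter (fun c => (wordMap φ)^[p] [c]) = GrowingLetter φ := by
  funext c
  refine propext (not_iff_not.1 ?_)
  refine (boundedLetter_iff (wordMap_iterate_ne_nil hφ p) c).trans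
    (Iff.trans ?_ (boundedLetter_iff hφ c).symm)
  simp only [wordMap_power, ← Function.iterate_mul]
  refine exists_congr fun C => ⟨fun h k => ?_, fun h k => h _⟩
  exact (monotone_length_iterate hφ [c] (Nat.le_mul_of_pos_left k hp)).trans (h k)

end Words

section Periodicity

variable {φ : A → List A}

/-- A bounded letter occurring in its own image under `φ ^ d` is fixed by `φ ^ d`. -/
theorem iterate_eq_self_of_mem (hφ : ∀ c, φ c ≠ []) {x : A} (hx : BoundedLetter φ x) {d : ℕ}
    (h : x ∈ (wordMap φ)^[d] [x]) : (wordMap φ)^[d] [x] = [x] := by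
  obtain ⟨u, v, huv⟩ := List.append_of_mem h
  by_contra hne
  have huv_pos : 0 < u.length + v.length := by
    by_contra hlen
    have hu : u = [] := List.length_eq_zero_iff.1 (by omega)
    have hv : v = [] := List.length_eq_zero_iff.1 (by omega)
    exact hne (by simp [huv, hu, hv])
  have hgrow : ∀ k, k ≤ ((wordMap φ)^[d * k] [x]).length := by
    intro k
    induction k with
    | zero => simp
    | succ k ih =>
      have hu := monotone_length_iterate hφ u (Nat.zero_le (d * k))
      have hv := monotone_length_iterate hφ v (Nat.zero_le (d * k))
      simp only [Function.iterate_zero, id_eq] at hu hv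
      rw [Nat.mul_succ, Function.iterate_add_apply, huv, ← List.singleton_append,
        wordMap_iterate_append, wordMap_iterate_append]
      simp only [List.length_append]
      omega
  obtain ⟨C, hC⟩ := (boundedLetter_iff hφ x).1 hx
  have := (hgrow (C + 1)).trans (hC _)
  omega

/-- Letters reached along a path through the images of `φ`. -/
theorem exists_letter_path {n : ℕ} {b z : A} (h : z ∈ (wordMap φ)^[n] [b]) :
    ∃ x : ℕ → A, x 0 = b ∧ x n = z ∧ ∀ i < n, x (i + 1) ∈ φ (x i) := by
  induction n generalizing z with
  | zero => exact ⟨fun _ => b, rfl, (List.mem_singleton.1 h).symm, by simp⟩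
  | succ n ih =>
    obtain ⟨y, hy, hz⟩ := mem_wordMap_iterate_add h
    obtain ⟨x, hx0, hxn, hx⟩ := ih hy
    refine ⟨fun i => if i ≤ n then x i else z, by simpa using hx0, by simp, fun i hi => ?_⟩
    rcases Nat.lt_succ_iff_lt_or_eq.1 hi with hi | rfl
    · simpa [hi.le, Nat.succ_le_of_lt hi] using hx i hi
    · simpa [hxn, wordMap_singleton] using hz

theorem mem_iterate_of_path {x : ℕ → A} {n : ℕ} (hx : ∀ i < n, x (i + 1) ∈ φ (x i)) {i k : ℕ}
    (hik : i + k ≤ n) : x (i + k) ∈ (wordMap φ)^[k] [x i] := by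
  induction k with
  | zero => simp
  | succ k ih =>
    rw [Function.iterate_succ_apply', wordMap, List.mem_flatMap]
    exact ⟨x (i + k), ih (by omega), hx (i + k) (by omega)⟩

/-- A sequence indexed by `0, …, card A` takes some value twice. -/
theorem exists_lt_le_card_eq [Fintype A] (x : ℕ → A) :
    ∃ i j, i < j ∧ j ≤ Fintype.card A ∧ x i = x j := by
  obtain ⟨i, j, hij, h⟩ := Fintype.exists_ne_map_eq_of_card_lt
    (fun i : Fin (Fintype.card A + 1) => x i) (by simp)
  rcases lt_or_gt_of_ne hij with hlt | hlt
  · exact ⟨i, j, hlt, by omega, h⟩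
  · exact ⟨j, i, hlt, by omega, h.symm⟩

theorem iterate_factorial_eq_self {α : Type*} {f : α → α} {x : α} {d n : ℕ} (hd : 0 < d)
    (hdn : d ≤ n) (h : f^[d] x = x) : f^[n.factorial] x = x :=
  Function.IsPeriodicPt.trans_dvd (m := d) h (Nat.dvd_factorial hd hdn)

/-- Every self-map of a finite type becomes idempotent at its `(card A)!`-th iterate. -/
theorem iterate_factorial_card_idem [Fintype A] (f : A → A) (x : A) :
    f^[(Fintype.card A).factorial] (f^[(Fintype.card A).factorial] x) =
      f^[(Fintype.card A).factorial] x := by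
  obtain ⟨i, j, hij, hj, h⟩ := exists_lt_le_card_eq fun k => f^[k] x
  obtain ⟨r, hr⟩ := Nat.exists_eq_add_of_le
    ((hij.le.trans hj).trans (Nat.self_le_factorial (Fintype.card A)))
  have hfix : f^[(Fintype.card A).factorial] (f^[i] x) = f^[i] x := by
    refine iterate_factorial_eq_self (d := j - i) (by omega) (by omega) ?_
    rw [← Function.iterate_add_apply, Nat.sub_add_cancel hij.le]
    exact h.symm
  have hsplit : f^[(Fintype.card A).factorial] x = f^[r] (f^[i] x) := by
    rw [← Function.iterate_add_apply, hr, add_comm]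
  rw [hsplit, (Function.Commute.refl f).iterate_iterate _ _ |>.eq, hfix]

/-- Letters of `φ ^ card A` of a bounded letter are fixed by `φ ^ (card A)!`. -/
theorem iterate_factorial_eq_singleton [Fintype A] (hφ : ∀ c, φ c ≠ []) {b z : A}
    (hb : BoundedLetter φ b) (hz : z ∈ (wordMap φ)^[Fintype.card A] [b]) :
    (wordMap φ)^[(Fintype.card A).factorial] [z] = [z] := by
  obtain ⟨x, hx0, hxn, hx⟩ := exists_letter_path hz
  obtain ⟨i, j, hij, hj, h⟩ := exists_lt_le_card_eq x
  have hbi : BoundedLetter φ (x i) := by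
    refine bounded_of_mem_iterate hφ hb (n := i) ?_
    have := mem_iterate_of_path hx (i := 0) (k := i) (by omega)
    rwa [hx0, zero_add] at this
  have hfix : (wordMap φ)^[j - i] [x i] = [x i] := by
    refine iterate_eq_self_of_mem hφ hbi ?_
    have := mem_iterate_of_path hx (i := i) (k := j - i) (by omega)
    rwa [Nat.add_sub_cancel' hij.le, ← h] at this
  have hmem := mem_iterate_of_path hx (i := i) (k := Fintype.card A - i) (by omega)
  rw [Nat.add_sub_cancel' (hij.le.trans hj), hxn] at hmem
  have hlen : ((wordMap φ)^[Fintype.card A - i] [x i]).length ≤ 1 := by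
    refine (monotone_length_iterate hφ [x i]
      (Nat.le_mul_of_pos_left (Fintype.card A - i) (Nat.sub_pos_of_lt hij))).trans ?_
    simp only [Function.iterate_mul, Function.iterate_fixed hfix, List.length_singleton, le_refl]
  have heq : (wordMap φ)^[Fintype.card A - i] [x i] = [z] := by
    obtain ⟨y, hy⟩ := List.length_eq_one_iff.1
      (le_antisymm hlen (List.length_pos_of_mem hmem))
    rw [hy] at hmem ⊢
    rw [List.mem_singleton.1 hmem]
  have hfix' := iterate_factorial_eq_self (by omega) (by omega : j - i ≤ Fintype.card A) hfix
  rw [← heq, (Function.Commute.refl (wordMap φ)).iterate_iterate _ _ |>.eq, hfix']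

theorem iterate_eq_self_of_forall_mem {m : ℕ} {w : List A}
    (h : ∀ z ∈ w, (wordMap φ)^[m] [z] = [z]) : (wordMap φ)^[m] w = w := by
  induction w with
  | nil => exact wordMap_iterate_nil φ m
  | cons c w ih =>
    rw [← List.singleton_append, wordMap_iterate_append, h c (by simp),
      ih fun z hz => h z (by simp [hz])]

theorem iterate_factorial_idem_of_bounded [Fintype A] (hφ : ∀ c, φ c ≠ []) {b : A}
    (hb : BoundedLetter φ b) :
    (wordMap φ)^[(Fintype.card A).factorial] ((wordMap φ)^[(Fintype.card A).factorial] [b]) =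
      (wordMap φ)^[(Fintype.card A).factorial] [b] := by
  obtain ⟨r, hr⟩ := Nat.exists_eq_add_of_le (Nat.self_le_factorial (Fintype.card A))
  have hsplit : (wordMap φ)^[(Fintype.card A).factorial] [b] =
      (wordMap φ)^[r] ((wordMap φ)^[Fintype.card A] [b]) := by
    rw [← Function.iterate_add_apply, hr, add_comm]
  rw [hsplit, (Function.Commute.refl (wordMap φ)).iterate_iterate _ _ |>.eq,
    iterate_eq_self_of_forall_mem fun z hz => iterate_factorial_eq_singleton hφ hb hz]

end Periodicity

section Left

variable {φ : A → List A}

theorem LBw_congr {ψ : A → List A} (h : GrowingLetter ψ = GrowingLetter φ) (u : List A) :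
    LBw ψ u = LBw φ u := by
  have hB : BoundedLetter ψ = BoundedLetter φ := funext fun c => congrArg Not (congrFun h c)
  rw [LBw, LBw, hB]

theorem LCl_congr [Inhabited A] {ψ : A → List A} (h : GrowingLetter ψ = GrowingLetter φ)
    (u : List A) : LCl ψ u = LCl φ u := by
  have hB : BoundedLetter ψ = BoundedLetter φ := funext fun c => congrArg Not (congrFun h c)
  rw [LCl, LCl, hB]

theorem LBw_append {u : List A} (hu : ∀ c ∈ u, BoundedLetter φ c) (v : List A) :
    LBw φ (u ++ v) = u ++ LBw φ v := by
  rw [LBw, LBw, List.takeWhile_append_of_pos (by simpa using hu)]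

theorem LCl_append [Inhabited A] {u : List A} (hu : ∀ c ∈ u, BoundedLetter φ c) (v : List A) :
    LCl φ (u ++ v) = LCl φ v := by
  rw [LCl, LCl, List.dropWhile_append_of_pos (by simpa using hu)]

theorem LBw_cons_of_growing {c : A} (hc : GrowingLetter φ c) (v : List A) :
    LBw φ (c :: v) = [] := by
  simp [LBw, BoundedLetter, hc]

theorem LCl_cons_of_growing [Inhabited A] {c : A} (hc : GrowingLetter φ c) (v : List A) :
    LCl φ (c :: v) = c := by
  simp [LCl, BoundedLetter, hc]

theorem exists_eq_append_growing_cons {u : List A} (hu : ∃ c ∈ u, GrowingLetter φ c) :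
    ∃ s c t, u = s ++ c :: t ∧ (∀ b ∈ s, BoundedLetter φ b) ∧ GrowingLetter φ c := by
  induction u with
  | nil => simp at hu
  | cons d u ih =>
    by_cases hd : GrowingLetter φ d
    · exact ⟨[], d, u, rfl, by simp, hd⟩
    · obtain ⟨s, c, t, rfl, hs, hc⟩ := ih (by simpa [hd] using hu)
      refine ⟨d :: s, c, t, rfl, ?_, hc⟩
      simpa [BoundedLetter, hd] using hs

theorem LBw_append_of_growing_mem {u : List A} (hu : ∃ c ∈ u, GrowingLetter φ c) (v : List A) :
    LBw φ (u ++ v) = LBw φ u := by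
  obtain ⟨s, c, t, rfl, hs, hc⟩ := exists_eq_append_growing_cons hu
  rw [List.append_assoc, List.cons_append, LBw_append hs, LBw_append hs, LBw_cons_of_growing hc,
    LBw_cons_of_growing hc]

theorem LCl_append_of_growing_mem [Inhabited A] {u : List A} (hu : ∃ c ∈ u, GrowingLetter φ c)
    (v : List A) : LCl φ (u ++ v) = LCl φ u := by
  obtain ⟨s, c, t, rfl, hs, hc⟩ := exists_eq_append_growing_cons hu
  rw [List.append_assoc, List.cons_append, LCl_append hs, LCl_append hs, LCl_cons_of_growing hc,
    LCl_cons_of_growing hc]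

theorem bounded_of_mem_LBw {u : List A} {b : A} (hb : b ∈ LBw φ u) : BoundedLetter φ b := by
  simpa using List.mem_takeWhile_imp hb

theorem growingLetter_LCl [Inhabited A] {u : List A} (hu : ∃ c ∈ u, GrowingLetter φ c) :
    GrowingLetter φ (LCl φ u) := by
  obtain ⟨s, c, t, rfl, hs, hc⟩ := exists_eq_append_growing_cons hu
  rwa [LCl_append hs, LCl_cons_of_growing hc]

theorem exists_growing_mem_wordMap (hφ : ∀ c, φ c ≠ []) {u : List A}
    (hu : ∃ c ∈ u, GrowingLetter φ c) : ∃ c ∈ wordMap φ u, GrowingLetter φ c := by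
  obtain ⟨c, hcu, hc⟩ := hu
  obtain ⟨d, hd, hgd⟩ := exists_growing_mem hφ hc
  exact ⟨d, List.mem_flatMap.2 ⟨c, hcu, hd⟩, hgd⟩

theorem exists_growing_mem_iterate (hφ : ∀ c, φ c ≠ []) {c : A} (hc : GrowingLetter φ c) (k : ℕ) :
    ∃ d ∈ (wordMap φ)^[k] [c], GrowingLetter φ d := by
  induction k with
  | zero => exact ⟨c, by simp, hc⟩
  | succ k ih =>
    rw [Function.iterate_succ_apply']
    exact exists_growing_mem_wordMap hφ ih

theorem LBw_LCl_wordMap [Inhabited A] (hφ : ∀ c, φ c ≠ []) {u : List A}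
    (hu : ∃ c ∈ u, GrowingLetter φ c) :
    LBw φ (wordMap φ u) = wordMap φ (LBw φ u) ++ LBw φ (φ (LCl φ u)) ∧
      LCl φ (wordMap φ u) = LCl φ (φ (LCl φ u)) := by
  obtain ⟨s, c, t, rfl, hs, hc⟩ := exists_eq_append_growing_cons hu
  have hs' : ∀ b ∈ wordMap φ s, BoundedLetter φ b := by
    intro b hb
    obtain ⟨y, hy, hby⟩ := List.mem_flatMap.1 hb
    exact bounded_of_mem hφ (hs y hy) hby
  have hg := exists_growing_mem hφ hc
  have hmap : wordMap φ (s ++ c :: t) = wordMap φ s ++ (φ c ++ wordMap φ t) := by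
    rw [wordMap_append, ← List.singleton_append, wordMap_append, wordMap_singleton]
  rw [hmap, LBw_append hs', LCl_append hs', LBw_append_of_growing_mem hg,
    LCl_append_of_growing_mem hg, LBw_append hs, LCl_append hs, LBw_cons_of_growing hc,
    LCl_cons_of_growing hc, List.append_nil]
  exact ⟨rfl, rfl⟩

/-- The first growing letter of `φ ^ k (c)` is obtained by iterating the first-growing-letter map. -/
theorem LCl_iterate [Inhabited A] (hφ : ∀ c, φ c ≠ []) {c : A} (hc : GrowingLetter φ c) (k : ℕ) :
    LCl φ ((wordMap φ)^[k] [c]) = (fun d => LCl φ (φ d))^[k] c := by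
  induction k with
  | zero => exact LCl_cons_of_growing hc []
  | succ k ih =>
    rw [Function.iterate_succ_apply', Function.iterate_succ_apply',
      (LBw_LCl_wordMap hφ (exists_growing_mem_iterate hφ hc k)).2, ih]

theorem wordMap_idem_of_bounded {ψ : A → List A}
    (hidem : ∀ b, BoundedLetter ψ b → wordMap ψ (ψ b) = ψ b) {w : List A}
    (hw : ∀ b ∈ w, BoundedLetter ψ b) : wordMap ψ (wordMap ψ w) = wordMap ψ w := by
  induction w with
  | nil => rfl
  | cons c w ih =>
    rw [← List.singleton_append, wordMap_append, wordMap_append, wordMap_singleton,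
      hidem c (hw c (by simp)), ih fun b hb => hw b (by simp [hb])]

/-- The left half of strong 1-periodicity, for a non-erasing morphism which is idempotent on
bounded letters and whose first-growing-letter map is idempotent on growing letters. -/
theorem LBw_iterate_of_idem [Inhabited A] {ψ : A → List A} (hψ : ∀ c, ψ c ≠ [])
    (hidem : ∀ b, BoundedLetter ψ b → wordMap ψ (ψ b) = ψ b)
    (hLC : ∀ c, GrowingLetter ψ c → LCl ψ (ψ (LCl ψ (ψ c))) = LCl ψ (ψ c))
    {c : A} (hc : GrowingLetter ψ c) (m : ℕ) :
    LBw ψ ((wordMap ψ)^[m + 2] [c]) =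
      LEw ψ c ++ (List.replicate m (LPw ψ c)).flatten ++ LKw ψ c := by
  have hLCl : ∀ k, LCl ψ ((wordMap ψ)^[k + 1] [c]) = LCl ψ (ψ c) := by
    intro k
    induction k with
    | zero => simp [wordMap_singleton]
    | succ k ih =>
      rw [Function.iterate_succ_apply',
        (LBw_LCl_wordMap hψ (exists_growing_mem_iterate hψ hc (k + 1))).2, ih, hLC c hc]
  have hstep : ∀ k, LBw ψ ((wordMap ψ)^[k + 2] [c]) =
      wordMap ψ (LBw ψ ((wordMap ψ)^[k + 1] [c])) ++ LKw ψ c := by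
    intro k
    rw [Function.iterate_succ_apply',
      (LBw_LCl_wordMap hψ (exists_growing_mem_iterate hψ hc (k + 1))).1, hLCl, LKw]
  induction m with
  | zero => rw [hstep]; simp [LEw, wordMap_singleton]
  | succ m ih =>
    have hLE : wordMap ψ (LEw ψ c) = LEw ψ c :=
      wordMap_idem_of_bounded hidem fun b hb => bounded_of_mem_LBw hb
    have hLP : wordMap ψ (LPw ψ c) = LPw ψ c :=
      wordMap_idem_of_bounded hidem fun b hb => bounded_of_mem_LBw hb
    have hLPs : ∀ n, wordMap ψ (List.replicate n (LPw ψ c)).flatten =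
        (List.replicate n (LPw ψ c)).flatten := by
      intro n
      induction n with
      | zero => rfl
      | succ n ihn => rw [List.replicate_succ, List.flatten_cons, wordMap_append, hLP, ihn]
    rw [hstep, ih, wordMap_append, wordMap_append, hLE, hLPs, ← LPw, List.replicate_succ',
      List.flatten_append, List.flatten_singleton]
    simp only [List.append_assoc]

theorem LBw_iterate_power_factorial [Fintype A] [Inhabited A] (hφ : ∀ c, φ c ≠ [])
    {ψ : A → List A} (hψ : ψ = fun c => (wordMap φ)^[(Fintype.card A).factorial] [c])
    {c : A} (hc : GrowingLetter ψ c) (m : ℕ) :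
    LBw ψ ((wordMap ψ)^[m + 2] [c]) =
      LEw ψ c ++ (List.replicate m (LPw ψ c)).flatten ++ LKw ψ c := by
  have hg : GrowingLetter ψ = GrowingLetter φ := by
    rw [hψ]
    exact growingLetter_power hφ (Nat.factorial_pos _)
  have hLCl : ∀ u, LCl ψ u = LCl φ u := LCl_congr hg
  have hne : ∀ c, ψ c ≠ [] := by
    rw [hψ]
    exact wordMap_iterate_ne_nil hφ _
  have hiter : ∀ d, GrowingLetter φ d →
      LCl φ (ψ d) = (fun d => LCl φ (φ d))^[(Fintype.card A).factorial] d := fun d hd => by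
    rw [hψ]
    exact LCl_iterate hφ hd _
  refine LBw_iterate_of_idem hne (fun b hb => ?_) (fun d hd => ?_) hc m
  · rw [BoundedLetter, hg] at hb
    rw [hψ, wordMap_power]
    exact iterate_factorial_idem_of_bounded hφ hb
  · have hd' := growingLetter_LCl (exists_growing_mem hne hd)
    rw [hg] at hd hd'
    rw [hLCl] at hd' ⊢
    rw [hLCl, hiter _ hd', hiter d hd, iterate_factorial_card_idem]

end Left

section Reversal

/-- The mirror image of a morphism. -/
def mirror (φ : A → List A) (c : A) : List A := (φ c).reverse

theorem wordMap_mirror (φ : A → List A) (w : List A) :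
    wordMap (mirror φ) w = (wordMap φ w.reverse).reverse := by
  induction w with
  | nil => rfl
  | cons c w ih =>
    rw [List.reverse_cons, wordMap_append, List.reverse_append, ← ih, wordMap_singleton,
      ← List.singleton_append, wordMap_append, wordMap_singleton, mirror]

theorem wordMap_mirror_iterate (φ : A → List A) (k : ℕ) (w : List A) :
    (wordMap (mirror φ))^[k] w = ((wordMap φ)^[k] w.reverse).reverse := by
  induction k with
  | zero => simp
  | succ k ih => rw [Function.iterate_succ_apply', Function.iterate_succ_apply', ih,
      wordMap_mirror, List.reverse_reverse]

theorem growingLetter_mirror (φ : A → List A) : GrowingLetter (mirror φ) = GrowingLetter φ := by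
  funext c
  simp only [GrowingLetter, wordMap_mirror_iterate, List.length_reverse, List.reverse_singleton]

theorem LBw_mirror (φ : A → List A) (u : List A) :
    LBw (mirror φ) u = (RBw φ u.reverse).reverse := by
  rw [LBw_congr (growingLetter_mirror φ), RBw, List.reverse_reverse, List.reverse_reverse]

theorem LCl_mirror [Inhabited A] (φ : A → List A) (u : List A) :
    LCl (mirror φ) u = RCl φ u.reverse := by
  rw [LCl_congr (growingLetter_mirror φ), RCl, List.reverse_reverse]

theorem LEw_mirror (ψ : A → List A) (c : A) : LEw (mirror ψ) c = (REw ψ c).reverse := by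
  simp [LEw, REw, wordMap_mirror, LBw_mirror, mirror]

theorem LKw_mirror [Inhabited A] (ψ : A → List A) (c : A) :
    LKw (mirror ψ) c = (RKw ψ c).reverse := by
  simp [LKw, RKw, LBw_mirror, LCl_mirror, mirror]

theorem LPw_mirror [Inhabited A] (ψ : A → List A) (c : A) :
    LPw (mirror ψ) c = (RPw ψ c).reverse := by
  simp [LPw, RPw, LKw_mirror, wordMap_mirror]

theorem RBw_iterate_power_factorial [Fintype A] [Inhabited A] {φ : A → List A}
    (hφ : ∀ c, φ c ≠ []) {ψ : A → List A}
    (hψ : ψ = fun c => (wordMap φ)^[(Fintype.card A).factorial] [c])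
    {c : A} (hc : GrowingLetter ψ c) (m : ℕ) :
    RBw ψ ((wordMap ψ)^[m + 2] [c]) =
      RKw ψ c ++ (List.replicate m (RPw ψ c)).flatten ++ REw ψ c := by
  have hmirror : mirror ψ =
      fun c => (wordMap (mirror φ))^[(Fintype.card A).factorial] [c] := by
    funext c
    simp [wordMap_mirror_iterate, mirror, hψ]
  rw [← growingLetter_mirror] at hc
  have h := LBw_iterate_power_factorial (φ := mirror φ) (by simpa [mirror] using hφ) hmirror hc m
  rw [LBw_mirror, wordMap_mirror_iterate, LEw_mirror, LKw_mirror, LPw_mirror] at h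
  have h' := congrArg List.reverse h
  simpa [List.reverse_flatten, List.append_assoc] using h'

end Reversal

/-- Every non-growing non-erasing morphism has a power, bounded by an explicit function of the
size of the alphabet, which is strongly 1-periodic. -/
theorem exists_strongly_one_periodic_power :
    ∃ F : ℕ → ℕ, ∀ (A : Type) [Fintype A] [Inhabited A] (φ : A → List A) (a : A),
      Prolongable φ a → ¬ Growing φ →
      (∀ (c : A) (k : ℕ), (wordMap φ)^[k] [c] ≠ []) →
      ∃ p : ℕ, 0 < p ∧ p ≤ F (Fintype.card A) ∧
        StronglyOnePeriodic (fun c => (wordMap φ)^[p] [c]) := by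
  refine ⟨Nat.factorial, fun A _ _ φ a _ _ hne => ⟨_, Nat.factorial_pos _, le_rfl, ?_⟩⟩
  have hφ : ∀ c, φ c ≠ [] := fun c => by simpa [wordMap_singleton] using hne c 1
  intro c hc l hl
  obtain ⟨m, rfl⟩ := Nat.exists_eq_add_of_le' hl
  exact ⟨LBw_iterate_power_factorial hφ rfl hc m, RBw_iterate_power_factorial hφ rfl hc m⟩
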